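/- arXiv:2212.06126 — 6 statements merged into one kernel-verified Lean document; each statement's English description precedes it below -/
import Mathlib

section
/- For every μ ∈ ℂ, the characteristic determinant of G satisfies det(μ • I_N − G) = μ^(N−2) · (μ² − M·(N−M)). In particular, besides the two eigenvalues ±√(M(N−M)), all remaining eigenvalues of G are zero. -/
/-- The characteristic determinant of `G` satisfies
`det (μ • I − G) = μ^(N−2) * (μ² − M(N−M))`; in particular, besides `±√(M(N−M))`,
all remaining eigenvalues of `G` are zero. -/
theorem stmt_2 (N M : ℕ) (hM : 0 < M) (hMN : M < N)
    (S : Finset (Fin N)) (hS : S.card = M)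
    (G : Matrix (Fin N) (Fin N) ℂ)
    (hG : ∀ i j, G i j = if (i ∈ S ∧ j ∉ S) ∨ (j ∈ S ∧ i ∉ S) then 1 else 0) :
    ∀ μ : ℂ, (μ • (1 : Matrix (Fin N) (Fin N) ℂ) - G).det =
      μ ^ (N - 2) * (μ ^ 2 - ((M * (N - M) : ℕ) : ℂ)) := by
  intro μ
  let A : Matrix (Fin N) (Fin 2) ℂ :=
    .of fun i => ![if i ∈ S then 1 else 0, if i ∈ S then 0 else 1]
  let B : Matrix (Fin 2) (Fin N) ℂ :=
    .of ![fun j => if j ∈ S then 0 else 1, fun j => if j ∈ S then 1 else 0]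
  have hGAB : G = A * B := by
    ext i j
    by_cases hi : i ∈ S <;> by_cases hj : j ∈ S <;>
      simp [hG, A, B, Matrix.mul_apply, Fin.sum_univ_two, hi, hj]
  have hcompl : (∑ i : Fin N, if i ∈ S then (0 : ℂ) else 1) = ((N - M : ℕ) : ℂ) := by
    have h : Sᶜ.card = N - M := by simp [Finset.card_compl, hS]
    rw [← h, Finset.compl_eq_univ_sdiff, ← Finset.filter_notMem_eq_sdiff, ← Finset.sum_boole]
    simp only [ite_not]
  have hBA : B * A = !![0, ((N - M : ℕ) : ℂ); (M : ℂ), 0] := by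
    ext i j
    rw [Matrix.mul_apply]
    fin_cases i <;> fin_cases j
    · refine Finset.sum_eq_zero fun k _ => ?_
      by_cases hk : k ∈ S <;> simp [A, B, hk]
    · refine Eq.trans (Finset.sum_congr rfl fun k _ => ?_) hcompl
      by_cases hk : k ∈ S <;> simp [A, B, hk]
    · simp [A, B, hS]
    · refine Finset.sum_eq_zero fun k _ => ?_
      by_cases hk : k ∈ S <;> simp [A, B, hk]
  have hle : Fintype.card (Fin 2) ≤ Fintype.card (Fin N) := by
    simp only [Fintype.card_fin]
    omega
  have h := congrArg (Polynomial.eval μ) (Matrix.charpoly_mul_comm_of_le A B hle)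
  rw [← hGAB, hBA, Matrix.eval_charpoly, Polynomial.eval_mul, Matrix.eval_charpoly] at h
  rw [Matrix.smul_one_eq_diagonal, ← Matrix.scalar_apply, h]
  simp only [Fintype.card_fin, Polynomial.eval_pow, Polynomial.eval_X, Nat.cast_mul]
  congr 1
  simp [Matrix.det_fin_two]
  ring
end

section
/- Every vector v ∈ ℂ^N that is orthogonal to both Ψ₊ and Ψ₋ lies in the kernel of G: if ⟨Ψ₊, v⟩ = 0 and ⟨Ψ₋, v⟩ = 0 then G ⬝ v = 0. -/
open Matrix

lemma sum_ite_mem_mul {ι R : Type*} [Fintype ι] [DecidableEq ι] [NonUnitalNonAssocSemiring R]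
    (S : Finset ι) (a b : R) (v : ι → R) :
    ∑ j, (if j ∈ S then a else b) * v j = a * ∑ j ∈ S, v j + b * ∑ j ∈ Sᶜ, v j := by
  rw [← Finset.sum_add_sum_compl S, Finset.mul_sum, Finset.mul_sum]
  congr 1 <;> refine Finset.sum_congr rfl fun j hj => ?_
  · rw [if_pos hj]
  · rw [if_neg (Finset.mem_compl.mp hj)]

/-- Every vector `v ∈ ℂ^N` orthogonal to both `Ψ₊` and `Ψ₋` lies in the kernel of `G`. -/
theorem stmt_3 (N M : ℕ) (hM : 0 < M) (hMN : M < N)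
    (S : Finset (Fin N)) (hS : S.card = M)
    (G : Matrix (Fin N) (Fin N) ℂ)
    (hG : ∀ i j, G i j = if (i ∈ S ∧ j ∉ S) ∨ (j ∈ S ∧ i ∉ S) then 1 else 0)
    (Ψp Ψm : Fin N → ℂ)
    (hΨp : ∀ j, Ψp j =
      if j ∈ S then ((Real.sqrt (2 * M) : ℝ) : ℂ)⁻¹
      else ((Real.sqrt (2 * ((N : ℝ) - M)) : ℝ) : ℂ)⁻¹)
    (hΨm : ∀ j, Ψm j =
      if j ∈ S then ((Real.sqrt (2 * M) : ℝ) : ℂ)⁻¹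
      else -((Real.sqrt (2 * ((N : ℝ) - M)) : ℝ) : ℂ)⁻¹)
    (v : Fin N → ℂ)
    (hvp : (∑ j, (starRingEnd ℂ) (Ψp j) * v j) = 0)
    (hvm : (∑ j, (starRingEnd ℂ) (Ψm j) * v j) = 0) :
    G.mulVec v = 0 := by
  have ha : ((Real.sqrt (2 * M) : ℝ) : ℂ)⁻¹ ≠ 0 := by
    have : (0 : ℝ) < M := mod_cast hM
    exact inv_ne_zero (Complex.ofReal_ne_zero.mpr (by positivity))
  have hb : ((Real.sqrt (2 * ((N : ℝ) - M)) : ℝ) : ℂ)⁻¹ ≠ 0 := by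
    have : (0 : ℝ) < (N : ℝ) - M := sub_pos.mpr (mod_cast hMN)
    exact inv_ne_zero (Complex.ofReal_ne_zero.mpr (by positivity))
  simp only [hΨp, hΨm, apply_ite (starRingEnd ℂ), map_neg, map_inv₀, Complex.conj_ofReal,
    sum_ite_mem_mul] at hvp hvm
  have hA : ∑ j ∈ S, v j = 0 :=
    (mul_eq_zero.mp (by linear_combination (hvp + hvm) / 2)).resolve_left ha
  have hB : ∑ j ∈ Sᶜ, v j = 0 :=
    (mul_eq_zero.mp (by linear_combination (hvp - hvm) / 2)).resolve_left hb
  ext i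
  have hrow : ∀ j, G i j = if j ∈ S then (if i ∈ S then 0 else 1) else (if i ∈ S then 1 else 0) := by
    intro j
    rw [hG]
    by_cases hi : i ∈ S <;> by_cases hj : j ∈ S <;> simp [hi, hj]
  simp only [Matrix.mulVec, dotProduct, hrow, sum_ite_mem_mul, hA, hB, mul_zero, add_zero,
    Pi.zero_apply]
end

section
/- G admits the rank-two spectral decomposition G = λ • (P₊ − P₋), where λ = √(M·(N−M)) and P± = Ψ± Ψ±* are the rank-one orthogonal projections onto Ψ₊ and Ψ₋ (i.e., (P±)_{ij} = (Ψ±)_i · conj((Ψ±)_j)). -/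
open Matrix

theorem sqrt_mul_two_mul_inv_sqrt_mul_inv_sqrt {x y : ℝ} (hx : 0 < x) (hy : 0 < y) :
    √(x * y) * (2 * ((√(2 * x))⁻¹ * (√(2 * y))⁻¹)) = 1 := by
  have h2 : √2 * √2 = (2 : ℝ) := Real.mul_self_sqrt zero_le_two
  have hx' : √x ≠ 0 := (Real.sqrt_pos.2 hx).ne'
  have hy' : √y ≠ 0 := (Real.sqrt_pos.2 hy).ne'
  rw [Real.sqrt_mul hx.le, Real.sqrt_mul zero_le_two x, Real.sqrt_mul zero_le_two y]
  field_simp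
  linarith

/-- `G` admits the rank-two spectral decomposition `G = λ • (P₊ − P₋)`, where
`λ = √(M(N−M))` and `P± = Ψ± Ψ±*` are the rank-one orthogonal projections onto `Ψ±`. -/
theorem stmt_5 (N M : ℕ) (hM : 0 < M) (hMN : M < N)
    (S : Finset (Fin N)) (hS : S.card = M)
    (G : Matrix (Fin N) (Fin N) ℂ)
    (hG : ∀ i j, G i j = if (i ∈ S ∧ j ∉ S) ∨ (j ∈ S ∧ i ∉ S) then 1 else 0)
    (Ψp Ψm : Fin N → ℂ)
    (hΨp : ∀ j, Ψp j =
      if j ∈ S then ((Real.sqrt (2 * M) : ℝ) : ℂ)⁻¹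
      else ((Real.sqrt (2 * ((N : ℝ) - M)) : ℝ) : ℂ)⁻¹)
    (hΨm : ∀ j, Ψm j =
      if j ∈ S then ((Real.sqrt (2 * M) : ℝ) : ℂ)⁻¹
      else -((Real.sqrt (2 * ((N : ℝ) - M)) : ℝ) : ℂ)⁻¹)
    (Pp Pm : Matrix (Fin N) (Fin N) ℂ)
    (hPp : ∀ i j, Pp i j = Ψp i * (starRingEnd ℂ) (Ψp j))
    (hPm : ∀ i j, Pm i j = Ψm i * (starRingEnd ℂ) (Ψm j))
    (lam : ℝ) (hlam : lam = Real.sqrt ((M : ℝ) * ((N : ℝ) - M))) :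
    G = (lam : ℂ) • (Pp - Pm) := by
  have hMpos : (0 : ℝ) < M := Nat.cast_pos.2 hM
  have hNM : (0 : ℝ) < (N : ℝ) - M := sub_pos.2 (Nat.cast_lt.2 hMN)
  have key := congrArg (fun r : ℝ => (r : ℂ)) (sqrt_mul_two_mul_inv_sqrt_mul_inv_sqrt hMpos hNM)
  rw [← hlam] at key
  push_cast at key
  ext i j
  rw [Matrix.smul_apply, Matrix.sub_apply, hG, hPp, hPm, hΨp, hΨp, hΨm, hΨm, smul_eq_mul]
  by_cases hi : i ∈ S <;> by_cases hj : j ∈ S <;>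
    simp only [hi, hj, if_true, if_false, not_true_eq_false, not_false_eq_true, and_true,
      and_false, or_true, or_false, map_neg, map_inv₀, Complex.conj_ofReal]
  · ring
  · linear_combination -key
  · linear_combination -key
  · ring
end

section
/- The matrix G satisfies the polynomial identity G³ = (M·(N−M)) • G (the algebraic identity underlying the fast-forwardability of G). -/
open Matrix

/-- Two orthogonal vectors `u`, `v` make `u vᵀ + v uᵀ` a root of `X³ - (u ⬝ u) (v ⬝ v) X`. -/
theorem vecMulVec_add_vecMulVec_pow_three {n R : Type*} [Fintype n] [DecidableEq n] [CommRing R]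
    (u v : n → R) (huv : u ⬝ᵥ v = 0) :
    (vecMulVec u v + vecMulVec v u) ^ 3 =
      ((u ⬝ᵥ u) * (v ⬝ᵥ v)) • (vecMulVec u v + vecMulVec v u) := by
  have hvu : v ⬝ᵥ u = 0 := by rw [dotProduct_comm, huv]
  simp only [pow_succ, pow_zero, one_mul, mul_add, add_mul, vecMulVec_mul_vecMulVec, huv, hvu,
    zero_smul, vecMulVec_zero, zero_add, add_zero, vecMulVec_smul, smul_mul_assoc, smul_zero,
    smul_add, smul_smul]
  simp only [mul_comm]

/-- The matrix `G` satisfies the polynomial identity `G³ = (M(N−M)) • G`. -/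
theorem stmt_6 (N M : ℕ) (hM : 0 < M) (hMN : M < N)
    (S : Finset (Fin N)) (hS : S.card = M)
    (G : Matrix (Fin N) (Fin N) ℂ)
    (hG : ∀ i j, G i j = if (i ∈ S ∧ j ∉ S) ∨ (j ∈ S ∧ i ∉ S) then 1 else 0) :
    G ^ 3 = ((M * (N - M) : ℕ) : ℂ) • G := by
  let u : Fin N → ℂ := fun i ↦ if i ∈ S then 1 else 0
  let v : Fin N → ℂ := fun i ↦ if i ∈ Sᶜ then 1 else 0
  have hGuv : G = vecMulVec u v + vecMulVec v u := by
    ext i j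
    by_cases hi : i ∈ S <;> by_cases hj : j ∈ S <;> simp [hG, u, v, vecMulVec_apply, hi, hj]
  have huv : u ⬝ᵥ v = 0 :=
    Finset.sum_eq_zero fun i _ ↦ by by_cases hi : i ∈ S <;> simp [u, v, hi]
  have huu : u ⬝ᵥ u = (M : ℂ) := by simp [dotProduct, u, hS]
  have hvv : v ⬝ᵥ v = ((N - M : ℕ) : ℂ) := by
    have hcard : Sᶜ.card = N - M := by rw [Finset.card_compl, Fintype.card_fin, hS]
    simp only [dotProduct, v, mul_ite, mul_one, mul_zero, ← ite_and, and_self,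
      Finset.sum_boole, Finset.filter_univ_mem, hcard]
  rw [hGuv, vecMulVec_add_vecMulVec_pow_three u v huv, huu, hvv, Nat.cast_mul]
end

section
/- The ℓ²→ℓ² operator norm of G equals √(M·(N−M)). In particular, for M = polylog(N) the norm of G grows as ~√N, so G cannot be block-encoded with a polylogarithmic normalization factor. -/
open Matrix

/-- The squared norm of the cut matrix of `S` applied to a vector, in terms of the sums of the
vector over `S` and over its complement. -/
theorem norm_sq_toEuclideanCLM_cut {ι : Type*} [Fintype ι] [DecidableEq ι] (S : Finset ι)
    (G : Matrix ι ι ℂ)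
    (hG : ∀ i j, G i j = if (i ∈ S ∧ j ∉ S) ∨ (j ∈ S ∧ i ∉ S) then 1 else 0)
    (x : EuclideanSpace ℂ ι) :
    ‖Matrix.toEuclideanCLM (𝕜 := ℂ) G x‖ ^ 2 =
      S.card * ‖∑ j ∈ Sᶜ, x j‖ ^ 2 + Sᶜ.card * ‖∑ j ∈ S, x j‖ ^ 2 := by
  have happ (i : ι) : Matrix.toEuclideanCLM (𝕜 := ℂ) G x i = ∑ j, G i j * x j := rfl
  have hin (i : ι) (hi : i ∈ S) :
      Matrix.toEuclideanCLM (𝕜 := ℂ) G x i = ∑ j ∈ Sᶜ, x j := by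
    rw [happ, ← Finset.sum_add_sum_compl S, Finset.sum_eq_zero, zero_add]
    · refine Finset.sum_congr rfl fun j hj => ?_
      rw [Finset.mem_compl] at hj
      simp [hG, hi, hj]
    · intro j hj
      simp [hG, hi, hj]
  have hout (i : ι) (hi : i ∈ Sᶜ) :
      Matrix.toEuclideanCLM (𝕜 := ℂ) G x i = ∑ j ∈ S, x j := by
    rw [Finset.mem_compl] at hi
    rw [happ, ← Finset.sum_add_sum_compl S, add_comm, Finset.sum_eq_zero, zero_add]
    · refine Finset.sum_congr rfl fun j hj => ?_
      simp [hG, hi, hj]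
    · intro j hj
      rw [Finset.mem_compl] at hj
      simp [hG, hi, hj]
  rw [EuclideanSpace.norm_sq_eq, ← Finset.sum_add_sum_compl S, ← nsmul_eq_mul, ← nsmul_eq_mul]
  congr 1
  · exact Finset.sum_eq_card_nsmul fun i hi => by rw [hin i hi]
  · exact Finset.sum_eq_card_nsmul fun i hi => by rw [hout i hi]

/-- Cauchy–Schwarz for a finite sum of vectors. -/
theorem norm_sum_sq_le_card_mul_sum_norm_sq {ι E : Type*} [SeminormedAddCommGroup E]
    (s : Finset ι) (f : ι → E) :
    ‖∑ j ∈ s, f j‖ ^ 2 ≤ s.card * ∑ j ∈ s, ‖f j‖ ^ 2 :=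
  (pow_le_pow_left₀ (norm_nonneg _) (norm_sum_le _ _) 2).trans sq_sum_le_card_mul_sum_sq

/-- The `ℓ²→ℓ²` operator norm of `G`, viewed as a linear operator on the Euclidean
space `ℂ^N`, equals `√(M(N−M))`. -/
theorem stmt_9 (N M : ℕ) (hM : 0 < M) (hMN : M < N)
    (S : Finset (Fin N)) (hS : S.card = M)
    (G : Matrix (Fin N) (Fin N) ℂ)
    (hG : ∀ i j, G i j = if (i ∈ S ∧ j ∉ S) ∨ (j ∈ S ∧ i ∉ S) then 1 else 0) :
    ‖Matrix.toEuclideanCLM (𝕜 := ℂ) G‖ = Real.sqrt ((M : ℝ) * ((N : ℝ) - M)) := by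
  have hSc : (Sᶜ.card : ℝ) = (N : ℝ) - M := by
    rw [Finset.card_compl, hS, Fintype.card_fin, Nat.cast_sub hMN.le]
  have hM' : (0 : ℝ) < M := Nat.cast_pos.mpr hM
  have hNM : (0 : ℝ) < (N : ℝ) - M := sub_pos.mpr (Nat.cast_lt.mpr hMN)
  apply le_antisymm
  · refine ContinuousLinearMap.opNorm_le_bound _ (Real.sqrt_nonneg _) fun x => ?_
    refine le_of_sq_le_sq ?_ (by positivity)
    rw [mul_pow, Real.sq_sqrt (by positivity), norm_sq_toEuclideanCLM_cut S G hG,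
      EuclideanSpace.norm_sq_eq, ← Finset.sum_add_sum_compl S, hS, hSc]
    have h₁ := norm_sum_sq_le_card_mul_sum_norm_sq S fun j => x j
    have h₂ := norm_sum_sq_le_card_mul_sum_norm_sq Sᶜ fun j => x j
    rw [hS] at h₁
    rw [hSc] at h₂
    linarith [mul_le_mul_of_nonneg_left h₁ hNM.le, mul_le_mul_of_nonneg_left h₂ hM'.le]
  · let x : EuclideanSpace ℂ (Fin N) := WithLp.toLp 2 fun j => if j ∈ S then 1 else 0
    have hx (j : Fin N) : x j = if j ∈ S then 1 else 0 := rfl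
    have hxS : ∑ j ∈ S, x j = M := by
      simp [hx, hS]
    have hxSc : ∑ j ∈ Sᶜ, x j = 0 :=
      Finset.sum_eq_zero fun j hj => by rw [hx, if_neg (Finset.mem_compl.mp hj)]
    have hnorm : ‖x‖ ^ 2 = M := by
      rw [EuclideanSpace.norm_sq_eq]
      simp [hx, apply_ite, hS]
    have hGx := norm_sq_toEuclideanCLM_cut S G hG x
    rw [hxS, hxSc, hSc, Complex.norm_natCast] at hGx
    have hle := pow_le_pow_left₀ (norm_nonneg _)
      ((Matrix.toEuclideanCLM (𝕜 := ℂ) G).le_opNorm x) 2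
    rw [mul_pow, hGx, hnorm] at hle
    refine Real.sqrt_le_iff.mpr ⟨norm_nonneg _, le_of_mul_le_mul_right ?_ hM'⟩
    rw [norm_zero] at hle
    linarith
end

section
/- For a hub-sparse network, the three matrices in the decomposition have small operator norm: the ℓ²→ℓ² operator norms satisfy ‖A_h‖ ≤ M, ‖A_r‖ ≤ s, and ‖A₋‖ ≤ max(h, M). Consequently ‖−A₋ + A_h + A_r‖ ≤ M + s + max(h, M). -/
open Matrix

/-- Schur test for symmetric matrices with nonnegative entries: the `ℓ²` operator norm is
bounded by any bound on the row sums. -/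
theorem norm_toEuclideanCLM_le_of_isSymm_of_row_sum_le {n : Type*} [Fintype n] [DecidableEq n]
    {B : Matrix n n ℝ} (hB : B.IsSymm) (hB0 : ∀ i j, 0 ≤ B i j) {r : ℝ} (hr : 0 ≤ r)
    (hrow : ∀ i, ∑ j, B i j ≤ r) :
    ‖Matrix.toEuclideanCLM (𝕜 := ℝ) B‖ ≤ r := by
  refine ContinuousLinearMap.opNorm_le_bound _ hr fun x ↦ ?_
  refine (sq_le_sq₀ (norm_nonneg _) (by positivity)).1 ?_
  have hrow_sq (i : n) : (∑ j, B i j * x j) ^ 2 ≤ r * ∑ j, B i j * x j ^ 2 :=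
    calc (∑ j, B i j * x j) ^ 2 ≤ (∑ j, B i j) * ∑ j, B i j * x j ^ 2 :=
          Finset.sum_sq_le_sum_mul_sum_of_sq_le_mul _ (fun j _ ↦ hB0 i j)
            (fun j _ ↦ mul_nonneg (hB0 i j) (sq_nonneg _)) (fun j _ ↦ le_of_eq (by ring))
      _ ≤ r * ∑ j, B i j * x j ^ 2 := by
          gcongr
          · exact Finset.sum_nonneg fun j _ ↦ mul_nonneg (hB0 i j) (sq_nonneg _)
          · exact hrow i
  rw [mul_pow, EuclideanSpace.real_norm_sq_eq, EuclideanSpace.real_norm_sq_eq]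
  simp only [Matrix.ofLp_toEuclideanCLM, Matrix.mulVec, dotProduct]
  calc ∑ i, (∑ j, B i j * x j) ^ 2 ≤ ∑ i, r * ∑ j, B i j * x j ^ 2 :=
        Finset.sum_le_sum fun i _ ↦ hrow_sq i
    _ = r * ∑ j, (∑ i, B j i) * x j ^ 2 := by
        rw [← Finset.mul_sum, Finset.sum_comm]
        simp only [Finset.sum_mul, hB.apply]
    _ ≤ r * ∑ j, r * x j ^ 2 := by
        gcongr with j
        exact hrow j
    _ = r ^ 2 * ∑ j, x j ^ 2 := by rw [← Finset.mul_sum]; ring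

/-- For a hub-sparse network, the three matrices in the decomposition have small
`ℓ²→ℓ²` operator norm: `‖A_h‖ ≤ M`, `‖A_r‖ ≤ s`, `‖A₋‖ ≤ max h M`, and consequently
`‖−A₋ + A_h + A_r‖ ≤ M + s + max h M`. -/
theorem stmt_11 (N M h s : ℕ) (A : Matrix (Fin N) (Fin N) ℝ)
    (hsymm : A.IsSymm)
    (hA : ∀ i j, A i j = 0 ∨ A i j = 1)
    (hdiag : ∀ i, A i i = 0)
    (S : Finset (Fin N)) (hS : S.card = M)
    (hhub : ∀ i ∈ S, (N : ℝ) - h ≤ ∑ j, A i j)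
    (hreg : ∀ i ∉ S, (∑ j, A i j) ≤ s)
    (Ah Ar Aminus : Matrix (Fin N) (Fin N) ℝ)
    (hAh : ∀ i j, Ah i j = if i ∈ S ∧ j ∈ S then A i j else 0)
    (hAr : ∀ i j, Ar i j = if i ∉ S ∧ j ∉ S then A i j else 0)
    (hAminus : ∀ i j, Aminus i j =
      if (i ∈ S ∧ j ∉ S) ∨ (j ∈ S ∧ i ∉ S) then 1 - A i j else 0) :
    ‖Matrix.toEuclideanCLM (𝕜 := ℝ) Ah‖ ≤ M ∧
    ‖Matrix.toEuclideanCLM (𝕜 := ℝ) Ar‖ ≤ s ∧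
    ‖Matrix.toEuclideanCLM (𝕜 := ℝ) Aminus‖ ≤ max (h : ℝ) (M : ℝ) ∧
    ‖Matrix.toEuclideanCLM (𝕜 := ℝ) (-Aminus + Ah + Ar)‖ ≤
      (M : ℝ) + (s : ℝ) + max (h : ℝ) (M : ℝ) := by
  have hA0 (i j) : 0 ≤ A i j := by rcases hA i j with e | e <;> simp [e]
  have hA1 (i j) : A i j ≤ 1 := by rcases hA i j with e | e <;> simp [e]
  have hAs (i j) : A i j = A j i := hsymm.apply j i
  have hcard : ∑ j, (if j ∈ S then (1 : ℝ) else 0) = M := by simp [hS]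
  have hAh_norm : ‖Matrix.toEuclideanCLM (𝕜 := ℝ) Ah‖ ≤ M := by
    refine norm_toEuclideanCLM_le_of_isSymm_of_row_sum_le
      (Matrix.IsSymm.ext fun i j ↦ ?_) (fun i j ↦ ?_) M.cast_nonneg fun i ↦ ?_
    · simp only [hAh, hAs j i, and_comm]
    · rw [hAh]; split_ifs <;> simp [hA0]
    · rw [← hcard]
      refine Finset.sum_le_sum fun j _ ↦ ?_
      rw [hAh]
      by_cases hi : i ∈ S <;> by_cases hj : j ∈ S <;> simp [hi, hj, hA1]
  have hAr_norm : ‖Matrix.toEuclideanCLM (𝕜 := ℝ) Ar‖ ≤ s := by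
    refine norm_toEuclideanCLM_le_of_isSymm_of_row_sum_le
      (Matrix.IsSymm.ext fun i j ↦ ?_) (fun i j ↦ ?_) s.cast_nonneg fun i ↦ ?_
    · simp only [hAr, hAs j i, and_comm]
    · rw [hAr]; split_ifs <;> simp [hA0]
    · by_cases hi : i ∈ S
      · simp [hAr, hi]
      · refine (Finset.sum_le_sum fun j _ ↦ ?_).trans (hreg i hi)
        rw [hAr]; split_ifs <;> simp [hA0]
  have hAminus_norm : ‖Matrix.toEuclideanCLM (𝕜 := ℝ) Aminus‖ ≤ max (h : ℝ) (M : ℝ) := by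
    refine norm_toEuclideanCLM_le_of_isSymm_of_row_sum_le
      (Matrix.IsSymm.ext fun i j ↦ ?_) (fun i j ↦ ?_) (by positivity) fun i ↦ ?_
    · simp only [hAminus, hAs j i, or_comm]
    · rw [hAminus]; split_ifs <;> simp [hA1]
    · by_cases hi : i ∈ S
      · refine le_max_of_le_left ?_
        calc ∑ j, Aminus i j ≤ ∑ j, (1 - A i j) := Finset.sum_le_sum fun j _ ↦ by
              rw [hAminus]; split_ifs <;> simp [hA1]
          _ = N - ∑ j, A i j := by simp [Finset.sum_sub_distrib]
          _ ≤ h := by linarith [hhub i hi]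
      · refine le_max_of_le_right ?_
        rw [← hcard]
        refine Finset.sum_le_sum fun j _ ↦ ?_
        rw [hAminus]
        by_cases hj : j ∈ S <;> simp [hi, hj, hA0]
  refine ⟨hAh_norm, hAr_norm, hAminus_norm, ?_⟩
  rw [map_add, map_add, map_neg]
  refine norm_add₃_le.trans ?_
  rw [norm_neg]
  linarith
end
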